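/- Let d ≥ 1, σ_w > 0, σ_b ≥ 0, and λ_l > 0 for l ≥ 1. Define functions g_l : [−1,1] → ℝ by g_0(z) = σ_b² + (σ_w²/d)·z and g_{l}(z) = g_{l−1}(z) + λ_l²·( σ_b² + (σ_w²/2)·β_{l−1}·f̂( g_{l−1}(z)/β_{l−1} ) ), where β_{l−1} = g_{l−1}(1) and f̂(γ) = (1/π)(γ·arcsin γ + √(1−γ²)) + γ/2. Then for every L ≥ 2 there exists a sequence (a_i)_{i∈ℕ} of strictly positive reals with ∑_i a_i < ∞ such that g_L(z) = ∑_{i≥0} a_i z^i for all z ∈ [−1,1]. -/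

import Mathlib

/-- The ReLU dual kernel function `f̂(γ) = (1/π)(γ arcsin γ + √(1-γ²)) + γ/2`. -/
noncomputable def fhat (γ : ℝ) : ℝ :=
  (1 / Real.pi) * (γ * Real.arcsin γ + Real.sqrt (1 - γ ^ 2)) + γ / 2

open Set Filter Topology

/-- The Taylor coefficients of `(1 - x) ^ (-1 / 2)` at the origin. -/
noncomputable def invSqrtCoeff (n : ℕ) : ℝ := Ring.choose ((1 / 2 : ℝ) + n - 1) n

theorem invSqrtCoeff_eq (n : ℕ) :
    invSqrtCoeff n = (ascPochhammer ℝ n).eval (1 / 2) / n.factorial := by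
  have h := Ring.factorial_nsmul_multichoose_eq_ascPochhammer (1 / 2 : ℝ) n
  rw [Polynomial.ascPochhammer_smeval_eq_eval] at h
  have hc : invSqrtCoeff n = Ring.multichoose (1 / 2 : ℝ) n := by
    rw [invSqrtCoeff, Ring.choose]
    congr 1
    ring
  rw [hc, ← h, nsmul_eq_mul]
  field_simp

theorem invSqrtCoeff_pos_and_le_one (n : ℕ) : 0 < invSqrtCoeff n ∧ invSqrtCoeff n ≤ 1 := by
  induction n with
  | zero => simp [invSqrtCoeff_eq]
  | succ n ih =>
    have h : invSqrtCoeff (n + 1) = invSqrtCoeff n * ((1 / 2 + n) / (n + 1)) := by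
      rw [invSqrtCoeff_eq, invSqrtCoeff_eq, ascPochhammer_succ_eval, Nat.factorial_succ]
      push_cast
      field_simp
    have hr : (1 / 2 + n : ℝ) / (n + 1) ≤ 1 := by
      rw [div_le_one (by positivity)]
      linarith
    rw [h]
    exact ⟨mul_pos ih.1 (by positivity), mul_le_one₀ ih.2 (by positivity) hr⟩

theorem hasSum_invSqrtCoeff {x : ℝ} (hx : |x| < 1) :
    HasSum (fun n => invSqrtCoeff n * x ^ n) (1 / √(1 - x)) := by
  have h := (Real.one_div_one_sub_rpow_hasFPowerSeriesOnBall_zero (1 / 2)).hasSum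
    (y := x) (by
      rw [← ENNReal.ofReal_one, Metric.eball_ofReal]
      simpa using hx)
  simpa [invSqrtCoeff, FormalMultilinearSeries.ofScalars_apply_eq, Real.sqrt_eq_rpow, mul_comm]
    using h

/-- Termwise integration of a power series with bounded coefficients and exponents `2n + j`. -/
theorem hasDerivAt_tsum_div_mul_pow {a : ℕ → ℝ} (ha : ∀ n, |a n| ≤ 1) (j : ℕ) {x : ℝ}
    (hx : |x| < 1) :
    HasDerivAt (fun y => ∑' n, a n / (2 * n + j + 1) * y ^ (2 * n + j + 1))
      (∑' n, a n * x ^ (2 * n + j)) x := by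
  obtain ⟨r, hxr, hr1⟩ := exists_between hx
  have hr0 : 0 ≤ r := (abs_nonneg x).trans hxr.le
  refine hasDerivAt_tsum_of_isPreconnected
    (g := fun n y => a n / (2 * n + j + 1) * y ^ (2 * n + j + 1))
    (g' := fun n y => a n * y ^ (2 * n + j)) (t := Metric.ball (0 : ℝ) r) (y₀ := 0)
    (u := fun n => r ^ n) (summable_geometric_of_lt_one hr0 hr1) Metric.isOpen_ball
    (convex_ball (0 : ℝ) r).isPreconnected (fun n y _ => ?_) (fun n y hy => ?_) ?_ ?_ ?_
  · have h := (hasDerivAt_pow (2 * n + j + 1) y).const_mul (a n / (2 * n + j + 1))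
    have hne : (2 * n + j + 1 : ℝ) ≠ 0 := by positivity
    refine h.congr_deriv ?_
    rw [Nat.add_sub_cancel, ← mul_assoc]
    push_cast
    rw [div_mul_cancel₀ _ hne]
  · have hy' : |y| ≤ r := by simpa using (Metric.mem_ball.1 hy).le
    rw [norm_mul, norm_pow, Real.norm_eq_abs, Real.norm_eq_abs]
    calc |a n| * |y| ^ (2 * n + j) ≤ 1 * r ^ (2 * n + j) := by
          gcongr
          exact ha n
      _ ≤ r ^ n := by
          rw [one_mul]
          exact pow_le_pow_of_le_one hr0 hr1.le (by omega)
  · simpa using (abs_nonneg x).trans_lt hxr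
  · simp
  · simpa using hxr

theorem eqOn_Ioo_of_hasDerivAt {f g f' : ℝ → ℝ}
    (hf : ∀ x ∈ Ioo (-1 : ℝ) 1, HasDerivAt f (f' x) x)
    (hg : ∀ x ∈ Ioo (-1 : ℝ) 1, HasDerivAt g (f' x) x) (h0 : f 0 = g 0) :
    EqOn f g (Ioo (-1) 1) :=
  isOpen_Ioo.eqOn_of_deriv_eq isPreconnected_Ioo
    (fun x hx => (hf x hx).differentiableAt.differentiableWithinAt)
    (fun x hx => (hg x hx).differentiableAt.differentiableWithinAt)
    (fun x hx => by rw [(hf x hx).deriv, (hg x hx).deriv]) (x := 0) (by norm_num) h0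

theorem arcsin_eq_tsum {x : ℝ} (hx : x ∈ Ioo (-1 : ℝ) 1) :
    Real.arcsin x = ∑' n, invSqrtCoeff n / (2 * n + 1) * x ^ (2 * n + 1) := by
  have habs (n : ℕ) : |invSqrtCoeff n| ≤ 1 := by
    rw [abs_of_pos (invSqrtCoeff_pos_and_le_one n).1]
    exact (invSqrtCoeff_pos_and_le_one n).2
  refine eqOn_Ioo_of_hasDerivAt (f' := fun x => 1 / √(1 - x ^ 2))
    (g := fun x => ∑' n, invSqrtCoeff n / (2 * n + 1) * x ^ (2 * n + 1))
    (fun y hy => Real.hasDerivAt_arcsin hy.1.ne' hy.2.ne) (fun y hy => ?_) (by simp) hx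
  have h := hasDerivAt_tsum_div_mul_pow habs 0 (abs_lt.2 hy)
  have hs := hasSum_invSqrtCoeff (x := y ^ 2) (by
    rw [abs_pow]
    exact pow_lt_one₀ (abs_nonneg _) (abs_lt.2 hy) two_ne_zero)
  rw [← hs.tsum_eq]
  simpa [pow_mul] using h

/-- The Taylor coefficients of `γ arcsin γ + √(1 - γ²) - 1`, along even exponents. -/
noncomputable def reluCoeff (n : ℕ) : ℝ := invSqrtCoeff n / (2 * n + 1) / (2 * n + 2)

theorem reluCoeff_pos (n : ℕ) : 0 < reluCoeff n := by
  have := (invSqrtCoeff_pos_and_le_one n).1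
  unfold reluCoeff
  positivity

theorem summable_reluCoeff : Summable reluCoeff := by
  have h : Summable fun n : ℕ => 1 / ((n + 1 : ℕ) : ℝ) ^ 2 :=
    (summable_nat_add_iff 1).2 (Real.summable_one_div_nat_pow.2 one_lt_two)
  refine h.of_nonneg_of_le (fun n => (reluCoeff_pos n).le) fun n => ?_
  rw [reluCoeff, div_div]
  have := (invSqrtCoeff_pos_and_le_one n).2
  push_cast
  gcongr
  nlinarith [(Nat.cast_nonneg n : (0 : ℝ) ≤ n)]

theorem norm_mul_pow_le {c x : ℝ} (hc : 0 ≤ c) (hx : x ∈ Icc (-1 : ℝ) 1) (n : ℕ) :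
    ‖c * x ^ n‖ ≤ c := by
  rw [norm_mul, norm_pow, Real.norm_of_nonneg hc, Real.norm_eq_abs]
  exact mul_le_of_le_one_right hc (pow_le_one₀ (abs_nonneg _) (abs_le.2 hx))

theorem hasSum_reluCoeff {x : ℝ} (hx : x ∈ Icc (-1 : ℝ) 1) :
    HasSum (fun n => reluCoeff n * x ^ (2 * n + 2))
      (x * Real.arcsin x + √(1 - x ^ 2) - 1) := by
  have hsum : Summable fun n => reluCoeff n * x ^ (2 * n + 2) :=
    summable_reluCoeff.of_norm_bounded fun n => norm_mul_pow_le (reluCoeff_pos n).le hx _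
  suffices h : EqOn (fun x => x * Real.arcsin x + √(1 - x ^ 2) - 1)
      (fun x => ∑' n, reluCoeff n * x ^ (2 * n + 2)) (Icc (-1) 1) by
    rw [show x * Real.arcsin x + √(1 - x ^ 2) - 1 = _ from h hx]
    exact hsum.hasSum
  have hIoo : EqOn (fun x => x * Real.arcsin x + √(1 - x ^ 2) - 1)
      (fun x => ∑' n, reluCoeff n * x ^ (2 * n + 2)) (Ioo (-1) 1) := by
    refine eqOn_Ioo_of_hasDerivAt (f' := Real.arcsin) (fun y hy => ?_) (fun y hy => ?_) (by simp)
    · have hpos : 0 < 1 - y ^ 2 := by nlinarith [hy.1, hy.2]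
      have h1 := (hasDerivAt_id y).mul (Real.hasDerivAt_arcsin hy.1.ne' hy.2.ne)
      have h2 := ((hasDerivAt_pow 2 y).const_sub 1).sqrt hpos.ne'
      have := (Real.sqrt_pos.2 hpos).ne'
      refine ((h1.add h2).sub_const 1).congr_deriv ?_
      simp
      field_simp
      ring
    · have h := hasDerivAt_tsum_div_mul_pow (a := fun n => invSqrtCoeff n / (2 * n + 1))
        (fun n => ?_) 1 (abs_lt.2 hy)
      · rw [arcsin_eq_tsum hy]
        convert h using 4 with z n
        · rw [reluCoeff]
          push_cast
          ring_nf
      · rw [abs_of_pos (div_pos (invSqrtCoeff_pos_and_le_one n).1 (by positivity))]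
        exact div_le_one_of_le₀ ((invSqrtCoeff_pos_and_le_one n).2.trans (by simp))
          (by positivity)
  refine hIoo.of_subset_closure (Continuous.continuousOn (by fun_prop)) ?_ Ioo_subset_Icc_self
    (by rw [closure_Ioo (by norm_num)])
  exact continuousOn_tsum (fun n => by fun_prop) summable_reluCoeff
    fun n y hy => norm_mul_pow_le (reluCoeff_pos n).le hy _

/-- `f` is on `[-1, 1]` the sum of an absolutely convergent power series with nonnegative
coefficients, those with index in `s` being strictly positive. -/
def HasPosSeries (s : Set ℕ) (f : ℝ → ℝ) : Prop :=
  ∃ a : ℕ → ℝ, (∀ i, 0 ≤ a i) ∧ (∀ i ∈ s, 0 < a i) ∧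
    ∀ z ∈ Icc (-1 : ℝ) 1, HasSum (fun i => a i * z ^ i) (f z)

namespace HasPosSeries

variable {s t : Set ℕ} {f g : ℝ → ℝ}

theorem congr (hf : HasPosSeries s f) (h : EqOn f g (Icc (-1) 1)) : HasPosSeries s g := by
  obtain ⟨a, ha, has, hsum⟩ := hf
  exact ⟨a, ha, has, fun z hz => h hz ▸ hsum z hz⟩

theorem mono (hf : HasPosSeries t f) (h : s ⊆ t) : HasPosSeries s f := by
  obtain ⟨a, ha, has, hsum⟩ := hf
  exact ⟨a, ha, fun i hi => has i (h hi), hsum⟩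

theorem abs_le (hf : HasPosSeries s f) {z : ℝ} (hz : z ∈ Icc (-1 : ℝ) 1) : |f z| ≤ f 1 := by
  obtain ⟨a, ha, -, hsum⟩ := hf
  have h1 : HasSum a (f 1) := by simpa using hsum 1 (by simp)
  exact (hsum z hz).norm_le_of_bounded h1 fun i => norm_mul_pow_le (ha i) hz i

theorem pos_of_mem (hf : HasPosSeries s f) {i : ℕ} (hi : i ∈ s) : 0 < f 1 := by
  obtain ⟨a, ha, has, hsum⟩ := hf
  have h1 : HasSum a (f 1) := by simpa using hsum 1 (by simp)
  exact (has i hi).trans_le (le_hasSum h1 i fun j _ => ha j)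

theorem zero : HasPosSeries ∅ fun _ => 0 :=
  ⟨0, by simp, by simp, fun z _ => by simp⟩

theorem monomial {c : ℝ} (hc : 0 < c) (n : ℕ) : HasPosSeries {n} fun z => c * z ^ n := by
  refine ⟨Pi.single n c, fun i => ?_, by simp [hc], fun z _ => ?_⟩
  · rcases eq_or_ne i n with rfl | h <;> simp [*, hc.le]
  · convert hasSum_single n (f := fun i => (Pi.single n c : ℕ → ℝ) i * z ^ i) ?_ using 1
    · simp
    · intro i hi
      simp [hi]

theorem const {c : ℝ} (hc : 0 < c) : HasPosSeries {0} fun _ => c := by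
  simpa using monomial hc 0

theorem const_of_nonneg {c : ℝ} (hc : 0 ≤ c) : HasPosSeries ∅ fun _ => c := by
  rcases hc.eq_or_lt with rfl | h
  · exact zero
  · exact (const h).mono (empty_subset _)

theorem add (hf : HasPosSeries s f) (hg : HasPosSeries t g) :
    HasPosSeries (s ∪ t) fun z => f z + g z := by
  obtain ⟨a, ha, has, hsum⟩ := hf
  obtain ⟨b, hb, hbt, hsum'⟩ := hg
  refine ⟨fun i => a i + b i, fun i => add_nonneg (ha i) (hb i), ?_, fun z hz => ?_⟩
  · rintro i (hi | hi)
    · exact add_pos_of_pos_of_nonneg (has i hi) (hb i)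
    · exact add_pos_of_nonneg_of_pos (ha i) (hbt i hi)
  · simpa only [add_mul] using (hsum z hz).add (hsum' z hz)

theorem const_mul (hf : HasPosSeries s f) {c : ℝ} (hc : 0 < c) :
    HasPosSeries s fun z => c * f z := by
  obtain ⟨a, ha, has, hsum⟩ := hf
  exact ⟨fun i => c * a i, fun i => mul_nonneg hc.le (ha i), fun i hi => mul_pos hc (has i hi),
    fun z hz => by simpa only [mul_assoc] using (hsum z hz).mul_left c⟩

open scoped Pointwise in
theorem mul (hf : HasPosSeries s f) (hg : HasPosSeries t g) :
    HasPosSeries (s + t) fun z => f z * g z := by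
  obtain ⟨a, ha, has, hsum⟩ := hf
  obtain ⟨b, hb, hbt, hsum'⟩ := hg
  have hnn (p : ℕ × ℕ) : 0 ≤ a p.1 * b p.2 := mul_nonneg (ha _) (hb _)
  refine ⟨fun n => ∑ p ∈ Finset.HasAntidiagonal.antidiagonal n, a p.1 * b p.2,
    fun n => Finset.sum_nonneg fun p _ => hnn p, ?_, fun z hz => ?_⟩
  · rintro _ ⟨i, hi, j, hj, rfl⟩
    exact Finset.sum_pos' (fun p _ => hnn p)
      ⟨(i, j), by simp, mul_pos (has i hi) (hbt j hj)⟩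
  · have h1 := (hsum z hz).summable.norm
    have h2 := (hsum' z hz).summable.norm
    have h := (summable_norm_sum_mul_antidiagonal_of_summable_norm h1 h2).of_norm.hasSum
    rw [← tsum_mul_tsum_eq_tsum_sum_antidiagonal_of_summable_norm h1 h2, (hsum z hz).tsum_eq,
      (hsum' z hz).tsum_eq] at h
    have hterm (n : ℕ) : ∑ p ∈ Finset.HasAntidiagonal.antidiagonal n,
        a p.1 * z ^ p.1 * (b p.2 * z ^ p.2) =
          (∑ p ∈ Finset.HasAntidiagonal.antidiagonal n, a p.1 * b p.2) * z ^ n := by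
      rw [Finset.sum_mul]
      refine Finset.sum_congr rfl fun p hp => ?_
      rw [← Finset.HasAntidiagonal.mem_antidiagonal.1 hp, pow_add]
      ring
    simpa only [hterm] using h

theorem pow_empty (hf : HasPosSeries s f) (n : ℕ) : HasPosSeries ∅ fun z => f z ^ n := by
  induction n with
  | zero => simpa using const_of_nonneg zero_le_one
  | succ n ih => simpa only [pow_succ] using (ih.mul hf).mono (empty_subset _)

theorem pow (hf : HasPosSeries {0, 1} f) (n : ℕ) : HasPosSeries (Iic n) fun z => f z ^ n := by
  induction n with
  | zero => simpa using (const one_pos).mono (by simp)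
  | succ n ih =>
    simp only [pow_succ]
    refine (ih.mul hf).mono fun i hi => ?_
    rcases Nat.le_or_eq_of_le_succ (mem_Iic.1 hi) with h | rfl
    · exact ⟨i, h, 0, by simp, rfl⟩
    · exact ⟨n, self_mem_Iic, 1, by simp, rfl⟩

theorem tsum {s : ℕ → Set ℕ} {f : ℕ → ℝ → ℝ} (hf : ∀ k, HasPosSeries (s k) (f k))
    (hsum : Summable fun k => f k 1) : HasPosSeries (⋃ k, s k) fun z => ∑' k, f k z := by
  choose a ha has hs using hf
  have h1 (k : ℕ) : HasSum (a k) (f k 1) := by simpa using hs k 1 (by simp)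
  have hprod : Summable fun p : ℕ × ℕ => a p.1 p.2 :=
    (summable_prod_of_nonneg fun p => ha p.1 p.2).2
      ⟨fun k => (h1 k).summable, by simpa only [(h1 _).tsum_eq] using hsum⟩
  have hcol (i : ℕ) : Summable fun k => a k i := hprod.prod_symm.prod_factor i
  refine ⟨fun i => ∑' k, a k i, fun i => tsum_nonneg fun k => ha k i, fun i hi => ?_,
    fun z hz => ?_⟩
  · obtain ⟨k, hk⟩ := mem_iUnion.1 hi
    exact (hcol i).tsum_pos (fun k => ha k i) k (has k i hk)
  · have hz' : Summable fun p : ℕ × ℕ => a p.1 p.2 * z ^ p.2 :=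
      hprod.of_norm_bounded fun p => norm_mul_pow_le (ha _ _) hz _
    have hrow : HasSum (fun p : ℕ × ℕ => a p.1 p.2 * z ^ p.2) (∑' k, f k z) := by
      rw [← tsum_congr fun k => (hs k z hz).tsum_eq, ← hz'.tsum_prod]
      exact hz'.hasSum
    exact ((Equiv.prodComm ℕ ℕ).hasSum_iff.2 hrow).prod_fiberwise
      fun i => (hcol i).hasSum.mul_right (z ^ i)

theorem fhat_comp {t : ℕ → Set ℕ} (hf : HasPosSeries s f) (h1 : f 1 = 1)
    (hpow : ∀ k, HasPosSeries (t k) fun z => f z ^ (2 * k + 2)) :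
    HasPosSeries ({0} ∪ s ∪ ⋃ k, t k) fun z => fhat (f z) := by
  have hsum : HasPosSeries (⋃ k, t k) fun z => ∑' k, reluCoeff k * f z ^ (2 * k + 2) :=
    tsum (fun k => (hpow k).const_mul (reluCoeff_pos k)) (by simpa [h1] using summable_reluCoeff)
  have hpi : 0 < 1 / Real.pi := one_div_pos.2 Real.pi_pos
  refine (((const hpi).add (hf.const_mul one_half_pos)).add (hsum.const_mul hpi)).congr
    fun z hz => ?_
  have hfz := hasSum_reluCoeff (_root_.abs_le.1 (h1 ▸ hf.abs_le hz))
  simp only [hfz.tsum_eq, fhat]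
  ring

theorem fhat_comp_union (hf : HasPosSeries s f) (h1 : f 1 = 1) :
    HasPosSeries ({0} ∪ s) fun z => fhat (f z) :=
  (hf.fhat_comp h1 fun _ => hf.pow_empty _).mono subset_union_left

theorem fhat_comp_univ (hf : HasPosSeries {0, 1} f) (h1 : f 1 = 1) :
    HasPosSeries univ fun z => fhat (f z) :=
  (hf.fhat_comp h1 fun _ => hf.pow _).mono fun i _ =>
    Or.inr (mem_iUnion.2 ⟨i, mem_Iic.2 (by omega)⟩)

theorem resnet_step (hf : HasPosSeries s f) (hpos : 0 < f 1) {lam σb σw : ℝ} (hlam : 0 < lam)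
    (hσw : 0 < σw) (hfhat : HasPosSeries t fun z => fhat (f z / f 1)) :
    HasPosSeries (s ∪ t)
      fun z => f z + lam ^ 2 * (σb ^ 2 + σw ^ 2 / 2 * f 1 * fhat (f z / f 1)) := by
  have h := (const_of_nonneg (sq_nonneg σb)).add
    (hfhat.const_mul (c := σw ^ 2 / 2 * f 1) (by positivity))
  simpa using hf.add (h.const_mul (c := lam ^ 2) (by positivity))

theorem normalize (hf : HasPosSeries s f) (hpos : 0 < f 1) :
    HasPosSeries s fun z => f z / f 1 := by
  simpa only [div_eq_inv_mul] using hf.const_mul (inv_pos.2 hpos)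

end HasPosSeries

/-- On the sphere, the zonal representation `g_L` of the depth-`L` ResNet NNGP kernel is,
for `L ≥ 2`, an absolutely convergent power series in `z = x·x′` with all coefficients
strictly positive. -/
theorem stmt13 (d : ℕ) (hd : 1 ≤ d) (σw σb : ℝ) (hσw : 0 < σw) (hσb : 0 ≤ σb)
    (lam : ℕ → ℝ) (hlam : ∀ l, 1 ≤ l → 0 < lam l)
    (g : ℕ → ℝ → ℝ)
    (h0 : ∀ z, g 0 z = σb ^ 2 + σw ^ 2 / d * z)
    (hrec : ∀ l z, g (l + 1) z =
      g l z + (lam (l + 1)) ^ 2 *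
        (σb ^ 2 + σw ^ 2 / 2 * g l 1 * fhat (g l z / g l 1))) :
    ∀ L : ℕ, 2 ≤ L → ∃ a : ℕ → ℝ, (∀ i, 0 < a i) ∧ Summable a ∧
      ∀ z ∈ Set.Icc (-1 : ℝ) 1, g L z = ∑' i : ℕ, a i * z ^ i := by
  have hzero : HasPosSeries {1} (g 0) := by
    have hd' : (0 : ℝ) < d := by exact_mod_cast hd
    have h := (HasPosSeries.const_of_nonneg (sq_nonneg σb)).add
      (HasPosSeries.monomial (c := σw ^ 2 / d) (by positivity) 1)
    simpa [← h0] using h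
  have hone : HasPosSeries {0, 1} (g 1) := by
    have hpos : 0 < g 0 1 := hzero.pos_of_mem (mem_singleton 1)
    have h := (hzero.normalize hpos).fhat_comp_union (div_self hpos.ne')
    have h' := hzero.resnet_step (σb := σb) hpos (hlam 1 le_rfl) hσw h
    exact (h'.mono (by simp)).congr fun z _ => (hrec 0 z).symm
  have hstep (l : ℕ) (h : HasPosSeries {0, 1} (g l)) : HasPosSeries univ (g (l + 1)) := by
    have hpos : 0 < g l 1 := h.pos_of_mem (mem_insert 0 {1})
    have h' := h.resnet_step (σb := σb) hpos (hlam (l + 1) (by omega)) hσw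
      ((h.normalize hpos).fhat_comp_univ (div_self hpos.ne'))
    exact (h'.mono subset_union_right).congr fun z _ => (hrec l z).symm
  intro L hL
  have huniv : HasPosSeries univ (g L) := by
    induction L, hL using Nat.le_induction with
    | base => exact hstep 1 hone
    | succ l _ ih => exact hstep l (ih.mono (subset_univ _))
  obtain ⟨a, -, ha, hsum⟩ := huniv
  refine ⟨a, fun i => ha i (mem_univ i), ?_, fun z hz => (hsum z hz).tsum_eq.symm⟩
  simpa using (hsum 1 (by simp)).summable
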